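/- Assume J = 0 and W = [[e^{h_A}, e^{h_AB}], [e^{h_AB}, e^{h_B}]] positive definite, and let α ∈ (0,1) ∩ ℚ. Then Z_N / Z*_N → 1 as N → ∞ (along N with αN ∈ ℕ), where Z_N = E[(1+ξ_A)^{N_A}(1+ξ_B)^{N_B}] and Z*_N = E[(1+ξ_A)^{N_A}(1+ξ_B)^{N_B}·1_Q(ξ)] with ξ = (ξ_A,ξ_B) a centred Gaussian vector of covariance W/N and Q = {ξ : 1+ξ_A > 0, 1+ξ_B > 0}; here N_A = αN and N_B = (1−α)N. -/

import Mathlib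

noncomputable section
open Real Matrix MeasureTheory Filter Topology

/-- The covariance matrix W. -/
def covW (hA hB hAB : ℝ) : Matrix (Fin 2) (Fin 2) ℝ :=
  !![Real.exp hA, Real.exp hAB; Real.exp hAB, Real.exp hB]

/-- Density of a centred Gaussian vector on ℝ² with covariance matrix `S`. -/
def gaussDensity (S : Matrix (Fin 2) (Fin 2) ℝ) (x : Fin 2 → ℝ) : ℝ :=
  (2 * Real.pi)⁻¹ * (Real.sqrt S.det)⁻¹ *
    Real.exp (-(1 / 2) * (S⁻¹.mulVec x ⬝ᵥ x))

/-- The Gaussian representation Z_N = E[(1+ξ_A)^{N_A} (1+ξ_B)^{N_B}], where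
`(ξ_A, ξ_B)` is centred Gaussian with covariance `W / (NA + NB)`. -/
def Zgauss (NA NB : ℕ) (hA hB hAB : ℝ) : ℝ :=
  ∫ x : Fin 2 → ℝ,
    (1 + x 0) ^ NA * (1 + x 1) ^ NB *
      gaussDensity (((NA + NB : ℕ) : ℝ)⁻¹ • covW hA hB hAB) x

/-- The modified partition function Z*: the expectation restricted to
`Q = {ξ : 1 + ξ_A > 0, 1 + ξ_B > 0}`. -/
def Zstar (NA NB : ℕ) (hA hB hAB : ℝ) : ℝ :=
  ∫ x : Fin 2 → ℝ in {x | -1 < x 0 ∧ -1 < x 1},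
    (1 + x 0) ^ NA * (1 + x 1) ^ NB *
      gaussDensity (((NA + NB : ℕ) : ℝ)⁻¹ • covW hA hB hAB) x


namespace S19

def F (NA NB : ℕ) (k t A B C : ℝ) (x : Fin 2 → ℝ) : ℝ :=
  (1 + x 0) ^ NA * (1 + x 1) ^ NB *
    (k * Real.exp (-(t * (B * x 0 ^ 2 - 2 * C * (x 0 * x 1) + A * x 1 ^ 2))))

def H (NA NB : ℕ) (k t A B C : ℝ) (x : Fin 2 → ℝ) : ℝ :=
  (1 + |x 0|) ^ NA * (1 + |x 1|) ^ NB *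
    (k * Real.exp (-(t * (B * x 0 ^ 2 - 2 * C * (|x 0| * |x 1|) + A * x 1 ^ 2))))

lemma F_cont (NA NB : ℕ) (k t A B C : ℝ) : Continuous (F NA NB k t A B C) := by
  unfold F; fun_prop

lemma H_cont (NA NB : ℕ) (k t A B C : ℝ) : Continuous (H NA NB k t A B C) := by
  unfold H; fun_prop

lemma H_pos (NA NB : ℕ) {k : ℝ} (hk : 0 < k) (t A B C : ℝ) (x : Fin 2 → ℝ) :
    0 < H NA NB k t A B C x := by
  unfold H; positivity

lemma F_le_H (NA NB : ℕ) {k t A B C : ℝ} (hk : 0 < k) (ht : 0 < t) (hC : 0 < C)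
    (x : Fin 2 → ℝ) : |F NA NB k t A B C x| ≤ H NA NB k t A B C x := by
  unfold F H
  rw [abs_mul, abs_mul, abs_pow, abs_pow, abs_mul, abs_of_pos hk, abs_of_pos (Real.exp_pos _)]
  have h1 : |1 + x 0| ≤ 1 + |x 0| := (abs_add_le _ _).trans (by simp)
  have h2 : |1 + x 1| ≤ 1 + |x 1| := (abs_add_le _ _).trans (by simp)
  have h3 : x 0 * x 1 ≤ |x 0| * |x 1| := by rw [← abs_mul]; exact le_abs_self _
  gcongr

lemma one_d (n : ℕ) {c : ℝ} (hc : 0 < c) :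
    Integrable (fun a : ℝ => (1 + |a|) ^ n * Real.exp (-(c * a ^ 2))) := by
  have hi := (integrable_exp_neg_mul_sq (half_pos hc)).const_mul
    ((n.factorial : ℝ) * Real.exp (1 + 1 / (2 * c)))
  refine hi.mono' (Continuous.aestronglyMeasurable (by fun_prop)) (Eventually.of_forall fun a => ?_)
  rw [Real.norm_of_nonneg (by positivity)]
  have h1 : (1 + |a|) ^ n ≤ n.factorial * Real.exp (1 + |a|) := by
    have := Real.pow_div_factorial_le_exp (1 + |a|) (by positivity) n
    rwa [div_le_iff₀ (by positivity), mul_comm] at this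
  have h2 : |a| ≤ c / 2 * a ^ 2 + 1 / (2 * c) := by
    have : c / 2 * a ^ 2 + 1 / (2 * c) - |a| = (c * |a| - 1) ^ 2 / (2 * c) := by
      rw [← sq_abs a]; field_simp; ring
    have h : 0 ≤ (c * |a| - 1) ^ 2 / (2 * c) := by positivity
    linarith
  calc (1 + |a|) ^ n * Real.exp (-(c * a ^ 2))
      ≤ n.factorial * Real.exp (1 + |a|) * Real.exp (-(c * a ^ 2)) := by gcongr
    _ = n.factorial * Real.exp (1 + |a| + -(c * a ^ 2)) := by rw [mul_assoc, ← Real.exp_add]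
    _ ≤ n.factorial * Real.exp (1 + 1 / (2 * c) + -(c / 2) * a ^ 2) := by
        refine mul_le_mul_of_nonneg_left (Real.exp_le_exp.2 ?_) (by positivity)
        linarith
    _ = _ := by rw [mul_assoc, ← Real.exp_add]

lemma q_lower {A B C D : ℝ} (hA : 0 < A) (hD : D = A * B - C ^ 2) (u v : ℝ) :
    D * u ^ 2 / A ≤ B * u ^ 2 - 2 * C * (u * v) + A * v ^ 2 := by
  rw [div_le_iff₀ hA, hD]
  nlinarith [sq_nonneg (C * u - A * v)]

lemma H_int (NA NB : ℕ) {k t A B C D : ℝ} (hk : 0 < k) (ht : 0 < t) (hA : 0 < A) (hB : 0 < B)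
    (hD : D = A * B - C ^ 2) (hD0 : 0 < D) : Integrable (H NA NB k t A B C) := by
  have hc0 : 0 < t * (D / (2 * A)) := by positivity
  have hc1 : 0 < t * (D / (2 * B)) := by positivity
  have hp : Integrable (fun x : Fin 2 → ℝ => ∏ i, (![fun a : ℝ => (1 + |a|) ^ NA * Real.exp (-(t * (D / (2 * A)) * a ^ 2)),
      fun a : ℝ => (1 + |a|) ^ NB * Real.exp (-(t * (D / (2 * B)) * a ^ 2))] i) (x i)) := by
    apply Integrable.fintype_prod (μ := fun _ : Fin 2 => (volume : Measure ℝ))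
    intro i
    fin_cases i
    · exact one_d NA hc0
    · exact one_d NB hc1
  refine (hp.const_mul k).mono' (H_cont ..).aestronglyMeasurable (Eventually.of_forall fun x => ?_)
  rw [Real.norm_of_nonneg (H_pos _ _ hk _ _ _ _ _).le]
  simp only [Fin.prod_univ_two, Matrix.cons_val_zero, Matrix.cons_val_one]
  unfold H
  have e1 := q_lower hA hD |x 0| |x 1|
  have e2 := q_lower (A := B) (B := A) (C := C) (D := D) hB (by rw [hD]; ring) |x 1| |x 0|
  rw [sq_abs, sq_abs] at e1 e2
  have e3 : D / (2 * A) * x 0 ^ 2 + D / (2 * B) * x 1 ^ 2 ≤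
      B * x 0 ^ 2 - 2 * C * (|x 0| * |x 1|) + A * x 1 ^ 2 := by
    have i1 : D / (2 * A) * x 0 ^ 2 = (D * x 0 ^ 2 / A) / 2 := by field_simp
    have i2 : D / (2 * B) * x 1 ^ 2 = (D * x 1 ^ 2 / B) / 2 := by field_simp
    rw [i1, i2]; linarith
  calc _ ≤ (1 + |x 0|) ^ NA * (1 + |x 1|) ^ NB *
      (k * Real.exp (-(t * (D / (2 * A) * x 0 ^ 2 + D / (2 * B) * x 1 ^ 2)))) := by gcongr
    _ = _ := by
      rw [mul_add, neg_add, Real.exp_add, ← mul_assoc t, ← mul_assoc t]; ring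

lemma flip_mp (s : Fin 2 → ℝ) (hs : ∀ i, s i = 1 ∨ s i = -1) :
    MeasurePreserving (fun x : Fin 2 → ℝ => fun i => s i * x i) volume volume := by
  refine volume_preserving_pi (α' := fun _ : Fin 2 => ℝ) (β' := fun _ : Fin 2 => ℝ) (f := fun i a => s i * a) (fun i => ?_)
  rcases hs i with h | h
  · simpa [h, Function.id_def] using MeasurePreserving.id (volume : Measure ℝ)
  · simpa [h] using Measure.measurePreserving_neg (volume : Measure ℝ)

lemma H_int_le (NA NB : ℕ) {k t A B C D : ℝ} (hk : 0 < k) (ht : 0 < t) (hA : 0 < A) (hB : 0 < B)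
    (hC : 0 < C) (hD : D = A * B - C ^ 2) (hD0 : 0 < D) :
    ∫ x, H NA NB k t A B C x ≤
      4 * ∫ x in {x : Fin 2 → ℝ | -1 < x 0 ∧ -1 < x 1}, F NA NB k t A B C x := by
  have hHi := H_int NA NB hk ht hA hB hD hD0
  have hFi : Integrable (F NA NB k t A B C) :=
    hHi.mono' (F_cont ..).aestronglyMeasurable (Eventually.of_forall fun x => F_le_H _ _ hk ht hC x)
  set P : Set (Fin 2 → ℝ) := {x | 0 ≤ x 0 ∧ 0 ≤ x 1} with hPdef
  have hP : MeasurableSet P :=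
    ((isClosed_le continuous_const (continuous_apply 0)).inter
      (isClosed_le continuous_const (continuous_apply 1))).measurableSet
  have hQ : MeasurableSet {x : Fin 2 → ℝ | -1 < x 0 ∧ -1 < x 1} :=
    ((isOpen_lt continuous_const (continuous_apply 0)).inter
      (isOpen_lt continuous_const (continuous_apply 1))).measurableSet
  set g := P.indicator (F NA NB k t A B C) with hg
  have hgi : Integrable g := hFi.indicator hP
  have hg0 : ∀ x, 0 ≤ g x := fun x => Set.indicator_nonneg (fun x hx => by
    have := hx.1; have := hx.2
    unfold F; positivity) x
  have hgH : ∀ x y : Fin 2 → ℝ, x 0 = |y 0| → x 1 = |y 1| → g x = H NA NB k t A B C y := by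
    intro x y h0 h1
    have : x ∈ P := ⟨h0 ▸ abs_nonneg _, h1 ▸ abs_nonneg _⟩
    rw [hg, Set.indicator_of_mem this]
    simp only [F, H, h0, h1, sq_abs]
  have key : ∀ s : Fin 2 → ℝ, (∀ i, s i = 1 ∨ s i = -1) →
      Integrable (fun x : Fin 2 → ℝ => g (fun i => s i * x i)) ∧
      ∫ x : Fin 2 → ℝ, g (fun i => s i * x i) = ∫ x, g x := by
    intro s hs
    have hm := flip_mp s hs
    refine ⟨hm.integrable_comp_of_integrable hgi, ?_⟩
    conv_rhs => rw [← hm.map_eq]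
    rw [integral_map hm.measurable.aemeasurable]
    rw [hm.map_eq]; exact hgi.aestronglyMeasurable
  obtain ⟨i1, j1⟩ := key ![1, 1] (by intro i; fin_cases i <;> simp)
  obtain ⟨i2, j2⟩ := key ![1, -1] (by intro i; fin_cases i <;> simp)
  obtain ⟨i3, j3⟩ := key ![-1, 1] (by intro i; fin_cases i <;> simp)
  obtain ⟨i4, j4⟩ := key ![-1, -1] (by intro i; fin_cases i <;> simp)
  have hle : ∫ x, H NA NB k t A B C x ≤ ∫ x : Fin 2 → ℝ, (g (fun i => ![1, 1] i * x i) +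
      g (fun i => ![1, -1] i * x i) + g (fun i => ![-1, 1] i * x i) +
      g (fun i => ![-1, -1] i * x i)) := by
    refine integral_mono hHi (((i1.add i2).add i3).add i4) fun x => ?_
    have p1 := hg0 (fun i => ![1, 1] i * x i)
    have p2 := hg0 (fun i => ![1, -1] i * x i)
    have p3 := hg0 (fun i => ![-1, 1] i * x i)
    have p4 := hg0 (fun i => ![-1, -1] i * x i)
    simp only
    rcases le_total 0 (x 0) with h0 | h0 <;> rcases le_total 0 (x 1) with h1 | h1
    · have := hgH (fun i => ![1, 1] i * x i) x (by simp [abs_of_nonneg h0]) (by simp [abs_of_nonneg h1])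
      linarith
    · have := hgH (fun i => ![1, -1] i * x i) x (by simp [abs_of_nonneg h0]) (by simp [abs_of_nonpos h1])
      linarith
    · have := hgH (fun i => ![-1, 1] i * x i) x (by simp [abs_of_nonpos h0]) (by simp [abs_of_nonneg h1])
      linarith
    · have := hgH (fun i => ![-1, -1] i * x i) x (by simp [abs_of_nonpos h0]) (by simp [abs_of_nonpos h1])
      linarith
  have i12 := i1.add i2
  have i123 := i12.add i3
  simp only [Pi.add_def] at i12 i123
  rw [integral_add i123 i4, integral_add i12 i3, integral_add i1 i2, j1, j2, j3, j4] at hle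
  have hfin : ∫ x, g x ≤ ∫ x in {x : Fin 2 → ℝ | -1 < x 0 ∧ -1 < x 1}, F NA NB k t A B C x := by
    rw [hg, integral_indicator hP]
    refine setIntegral_mono_set hFi.integrableOn ?_ ?_
    · refine (ae_restrict_iff' hQ).2 (Eventually.of_forall fun x hx => ?_)
      have h0 : 0 < 1 + x 0 := by linarith [hx.1]
      have h1 : 0 < 1 + x 1 := by linarith [hx.2]
      simp only [Pi.zero_apply]
      unfold F; positivity
    · refine Eventually.of_forall ?_
      intro x hx
      exact ⟨by linarith [hx.1], by linarith [hx.2]⟩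
  linarith

lemma H_half (NA NB : ℕ) {k t A B C D K : ℝ} (hk : 0 < k) (hA : 0 < A) (hB : 0 < B)
    (hD : D = A * B - C ^ 2) (hD0 : 0 < D)
    (ht : t = ((NA + NB : ℕ) : ℝ) / (2 * D)) (hK : 0 < K)
    (hKA : 4 ≤ Real.exp (3 * K ^ 2 / (8 * A))) (hKB : 4 ≤ Real.exp (3 * K ^ 2 / (8 * B)))
    (x : Fin 2 → ℝ) (hx : K ≤ |x 0| ∨ K ≤ |x 1|) :
    H NA NB k t A B C x ≤ (1 / 2) ^ (NA + NB) * H NA NB k t A B C ((1 / 2 : ℝ) • x) := by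
  set q := B * x 0 ^ 2 - 2 * C * (|x 0| * |x 1|) + A * x 1 ^ 2 with hq
  have e1 := q_lower hA hD |x 0| |x 1|
  have e2 := q_lower (A := B) (B := A) (C := C) (D := D) hB (by rw [hD]; ring) |x 1| |x 0|
  rw [sq_abs (x 0), sq_abs (x 1)] at e1 e2
  have ht0 : 0 ≤ t := by rw [ht]; positivity
  have main : (4 : ℝ) ^ (NA + NB) ≤ Real.exp (t * (3 / 4 * q)) := by
    rcases hx with h | h
    · calc (4 : ℝ) ^ (NA + NB) ≤ (Real.exp (3 * K ^ 2 / (8 * A))) ^ (NA + NB) := by gcongr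
        _ = Real.exp (((NA + NB : ℕ) : ℝ) * (3 * K ^ 2 / (8 * A))) := by rw [Real.exp_nat_mul]
        _ = Real.exp (t * (3 / 4 * (D * K ^ 2 / A))) := by
            congr 1; rw [ht]; field_simp; ring
        _ ≤ _ := by
            gcongr
            refine le_trans ?_ e1
            rw [← sq_abs (x 0)]
            gcongr
    · calc (4 : ℝ) ^ (NA + NB) ≤ (Real.exp (3 * K ^ 2 / (8 * B))) ^ (NA + NB) := by gcongr
        _ = Real.exp (((NA + NB : ℕ) : ℝ) * (3 * K ^ 2 / (8 * B))) := by rw [Real.exp_nat_mul]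
        _ = Real.exp (t * (3 / 4 * (D * K ^ 2 / B))) := by
            congr 1; rw [ht]; field_simp; ring
        _ ≤ _ := by
            gcongr
            refine le_trans ?_ (e2.trans (le_of_eq (by rw [hq]; ring)))
            rw [← sq_abs (x 1)]
            gcongr
  have hx0 : |((1 / 2 : ℝ) • x) 0| = |x 0| / 2 := by
    simp [abs_mul]; ring
  have hx1 : |((1 / 2 : ℝ) • x) 1| = |x 1| / 2 := by
    simp [abs_mul]; ring
  have hqh : B * ((1 / 2 : ℝ) • x) 0 ^ 2 - 2 * C * (|((1 / 2 : ℝ) • x) 0| * |((1 / 2 : ℝ) • x) 1|) +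
      A * ((1 / 2 : ℝ) • x) 1 ^ 2 = q / 4 := by
    rw [hx0, hx1, hq]; simp; ring
  unfold H
  rw [hqh, hx0, hx1, ← hq]
  have hexp : Real.exp (-(t * (q / 4))) = Real.exp (-(t * q)) * Real.exp (t * (3 / 4 * q)) := by
    rw [← Real.exp_add]; congr 1; ring
  rw [hexp]
  have b0 : (1 + |x 0|) ^ NA ≤ 2 ^ NA * (1 + |x 0| / 2) ^ NA := by
    rw [← mul_pow]; gcongr; linarith [abs_nonneg (x 0)]
  have b1 : (1 + |x 1|) ^ NB ≤ 2 ^ NB * (1 + |x 1| / 2) ^ NB := by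
    rw [← mul_pow]; gcongr; linarith [abs_nonneg (x 1)]
  calc _ ≤ (2 ^ NA * (1 + |x 0| / 2) ^ NA) * (2 ^ NB * (1 + |x 1| / 2) ^ NB) *
        (k * Real.exp (-(t * q))) := by gcongr
    _ = (1 / 2) ^ (NA + NB) * ((1 + |x 0| / 2) ^ NA * (1 + |x 1| / 2) ^ NB *
        (k * (Real.exp (-(t * q)) * 4 ^ (NA + NB)))) := by
        have : (2 : ℝ) ^ NA * 2 ^ NB = (1 / 2) ^ (NA + NB) * 4 ^ (NA + NB) := by
          rw [← pow_add, ← mul_pow]; norm_num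
        linear_combination ((1 + |x 0| / 2) ^ NA * (1 + |x 1| / 2) ^ NB *
        (k * Real.exp (-(t * q)))) * this
    _ ≤ _ := by gcongr

lemma refl_bound {K u : ℝ} (hK : 1 < K) (h : u ≤ -1) (hu : |u| ≤ K) :
    |1 + u| ≤ (K - 1) / (K + 1) * (1 + |u|) := by
  rw [abs_of_nonpos (by linarith : u ≤ 0)] at *
  rw [abs_of_nonpos (by linarith : 1 + u ≤ 0), div_mul_eq_mul_div, le_div_iff₀ (by linarith)]
  nlinarith

lemma F_bound (NA NB : ℕ) {k t A B C D K : ℝ} (hk : 0 < k) (ht0 : 0 < t) (hA : 0 < A) (hB : 0 < B)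
    (hC : 0 < C)
    (hD : D = A * B - C ^ 2) (hD0 : 0 < D)
    (ht : t = ((NA + NB : ℕ) : ℝ) / (2 * D)) (hK : 1 < K)
    (hKA : 4 ≤ Real.exp (3 * K ^ 2 / (8 * A))) (hKB : 4 ≤ Real.exp (3 * K ^ 2 / (8 * B)))
    (x : Fin 2 → ℝ) (hx : ¬ (-1 < x 0 ∧ -1 < x 1)) :
    |F NA NB k t A B C x| ≤
      (((K - 1) / (K + 1)) ^ NA + ((K - 1) / (K + 1)) ^ NB) * H NA NB k t A B C x +
      (1 / 2) ^ (NA + NB) * H NA NB k t A B C ((1 / 2 : ℝ) • x) := by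
  have hr : 0 < (K - 1) / (K + 1) := div_pos (by linarith) (by linarith)
  have hH := H_pos NA NB hk t A B C x
  have hH' := H_pos NA NB hk t A B C ((1 / 2 : ℝ) • x)
  by_cases hb : K ≤ |x 0| ∨ K ≤ |x 1|
  · have h1 := H_half NA NB (C := C) hk hA hB hD hD0 ht (by linarith) hKA hKB x hb
    have h2 := F_le_H NA NB (A := A) (B := B) hk ht0 hC x
    have : 0 ≤ (((K - 1) / (K + 1)) ^ NA + ((K - 1) / (K + 1)) ^ NB) * H NA NB k t A B C x := by
      positivity
    linarith
  · push Not at hb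
    have h3 : x 0 * x 1 ≤ |x 0| * |x 1| := by rw [← abs_mul]; exact le_abs_self _
    have g1 : |1 + x 0| ≤ 1 + |x 0| := (abs_add_le _ _).trans (by simp)
    have g2 : |1 + x 1| ≤ 1 + |x 1| := (abs_add_le _ _).trans (by simp)
    have hF : |F NA NB k t A B C x| = |1 + x 0| ^ NA * |1 + x 1| ^ NB *
        (k * Real.exp (-(t * (B * x 0 ^ 2 - 2 * C * (x 0 * x 1) + A * x 1 ^ 2)))) := by
      unfold F
      rw [abs_mul, abs_mul, abs_pow, abs_pow, abs_mul, abs_of_pos hk, abs_of_pos (Real.exp_pos _)]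
    have z1 : 0 ≤ (1 / 2) ^ (NA + NB) * H NA NB k t A B C ((1 / 2 : ℝ) • x) := by positivity
    have z2 : 0 ≤ ((K - 1) / (K + 1)) ^ NA * H NA NB k t A B C x := by positivity
    have z3 : 0 ≤ ((K - 1) / (K + 1)) ^ NB * H NA NB k t A B C x := by positivity
    by_cases h0 : -1 < x 0
    · have h1 : x 1 ≤ -1 := by by_contra h; exact hx ⟨h0, by linarith⟩
      have r := refl_bound hK h1 hb.2.le
      have : |F NA NB k t A B C x| ≤ ((K - 1) / (K + 1)) ^ NB * H NA NB k t A B C x := by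
        rw [hF]
        calc _ ≤ (1 + |x 0|) ^ NA * ((K - 1) / (K + 1) * (1 + |x 1|)) ^ NB *
              (k * Real.exp (-(t * (B * x 0 ^ 2 - 2 * C * (|x 0| * |x 1|) + A * x 1 ^ 2)))) := by
              gcongr
          _ = _ := by unfold H; rw [mul_pow]; ring
      linarith
    · have r := refl_bound hK (not_lt.1 h0) hb.1.le
      have : |F NA NB k t A B C x| ≤ ((K - 1) / (K + 1)) ^ NA * H NA NB k t A B C x := by
        rw [hF]
        calc _ ≤ ((K - 1) / (K + 1) * (1 + |x 0|)) ^ NA * (1 + |x 1|) ^ NB *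
              (k * Real.exp (-(t * (B * x 0 ^ 2 - 2 * C * (|x 0| * |x 1|) + A * x 1 ^ 2)))) := by
              gcongr
          _ = _ := by unfold H; rw [mul_pow]; ring
      linarith

lemma main_bound (NA NB : ℕ) {k t A B C D K : ℝ} (hk : 0 < k) (ht0 : 0 < t) (hA : 0 < A)
    (hB : 0 < B) (hC : 0 < C) (hD : D = A * B - C ^ 2) (hD0 : 0 < D)
    (ht : t = ((NA + NB : ℕ) : ℝ) / (2 * D)) (hK : 1 < K)
    (hKA : 4 ≤ Real.exp (3 * K ^ 2 / (8 * A))) (hKB : 4 ≤ Real.exp (3 * K ^ 2 / (8 * B))) :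
    |(∫ x, F NA NB k t A B C x) /
      (∫ x in {x : Fin 2 → ℝ | -1 < x 0 ∧ -1 < x 1}, F NA NB k t A B C x) - 1| ≤
      4 * (((K - 1) / (K + 1)) ^ NA + ((K - 1) / (K + 1)) ^ NB + 4 * (1 / 2) ^ (NA + NB)) := by
  have hr : 0 < (K - 1) / (K + 1) := div_pos (by linarith) (by linarith)
  have hHi := H_int NA NB hk ht0 hA hB hD hD0
  have hFi : Integrable (F NA NB k t A B C) :=
    hHi.mono' (F_cont ..).aestronglyMeasurable
      (Eventually.of_forall fun x => F_le_H _ _ hk ht0 hC x)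
  have hHle := H_int_le NA NB hk ht0 hA hB hC hD hD0
  set Q : Set (Fin 2 → ℝ) := {x : Fin 2 → ℝ | -1 < x 0 ∧ -1 < x 1} with hQdef
  have hQ : MeasurableSet Q :=
    ((isOpen_lt continuous_const (continuous_apply 0)).inter
      (isOpen_lt continuous_const (continuous_apply 1))).measurableSet
  have hHpos : 0 < ∫ x, H NA NB k t A B C x :=
    integral_pos_of_integrable_nonneg_nonzero (x := 0) (H_cont NA NB k t A B C) hHi
      (fun x => (H_pos NA NB hk t A B C x).le) (H_pos NA NB hk t A B C 0).ne'
  have hsplit := integral_add_compl hQ hFi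
  set Zs := ∫ x in Q, F NA NB k t A B C x with hZs
  have hZpos : 0 < Zs := by linarith
  have hhalf : ∫ x, H NA NB k t A B C ((1 / 2 : ℝ) • x) = 4 * ∫ x, H NA NB k t A B C x := by
    rw [Measure.integral_comp_smul]
    simp; left; norm_num
  have hHhi : Integrable (fun x => H NA NB k t A B C ((1 / 2 : ℝ) • x)) :=
    hHi.comp_smul (by norm_num)
  set r := ((K - 1) / (K + 1)) ^ NA + ((K - 1) / (K + 1)) ^ NB with hrr
  have hr0 : 0 < r := by positivity
  have hint : Integrable (fun x => r * H NA NB k t A B C x +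
      (1 / 2) ^ (NA + NB) * H NA NB k t A B C ((1 / 2 : ℝ) • x)) :=
    (hHi.const_mul _).add (hHhi.const_mul _)
  have hc : |∫ x in Qᶜ, F NA NB k t A B C x| ≤
      (r + 4 * (1 / 2) ^ (NA + NB)) * ∫ x, H NA NB k t A B C x := by
    calc _ ≤ ∫ x in Qᶜ, |F NA NB k t A B C x| := abs_integral_le_integral_abs
      _ ≤ ∫ x in Qᶜ, (r * H NA NB k t A B C x +
          (1 / 2) ^ (NA + NB) * H NA NB k t A B C ((1 / 2 : ℝ) • x)) := by
          refine setIntegral_mono_on hFi.abs.integrableOn hint.integrableOn hQ.compl ?_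
          intro x hx
          exact F_bound NA NB hk ht0 hA hB hC hD hD0 ht hK hKA hKB x hx
      _ ≤ ∫ x, (r * H NA NB k t A B C x +
          (1 / 2) ^ (NA + NB) * H NA NB k t A B C ((1 / 2 : ℝ) • x)) := by
          refine setIntegral_le_integral hint (Eventually.of_forall fun x => ?_)
          have hH := H_pos NA NB hk t A B C x
          have hH' := H_pos NA NB hk t A B C ((1 / 2 : ℝ) • x)
          simp only [Pi.zero_apply]
          positivity
      _ = _ := by
          rw [integral_add (hHi.const_mul _) (hHhi.const_mul _), integral_const_mul,
            integral_const_mul, hhalf]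
          ring
  rw [← hsplit]
  have : (Zs + ∫ x in Qᶜ, F NA NB k t A B C x) / Zs - 1 =
      (∫ x in Qᶜ, F NA NB k t A B C x) / Zs := by field_simp; ring
  rw [this, abs_div, abs_of_pos hZpos, div_le_iff₀ hZpos]
  calc _ ≤ _ := hc
    _ ≤ (r + 4 * (1 / 2) ^ (NA + NB)) * (4 * Zs) := by gcongr
    _ = _ := by ring

lemma dens_eq {A B C D n : ℝ} (hn : 0 < n) (hD : D = A * B - C ^ 2) (hD0 : 0 < D)
    (x : Fin 2 → ℝ) :
    gaussDensity (n⁻¹ • !![A, C; C, B]) x =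
      ((2 * Real.pi)⁻¹ * (Real.sqrt (n⁻¹ • !![A, C; C, B] : Matrix (Fin 2) (Fin 2) ℝ).det)⁻¹) *
      Real.exp (-(n / (2 * D) * (B * x 0 ^ 2 - 2 * C * (x 0 * x 1) + A * x 1 ^ 2))) := by
  unfold gaussDensity
  congr 2
  have hdet : (n⁻¹ • !![A, C; C, B] : Matrix (Fin 2) (Fin 2) ℝ).det = D / n ^ 2 := by
    rw [Matrix.det_fin_two, hD]; simp; field_simp
  rw [Matrix.inv_def, hdet, Matrix.adjugate_fin_two]
  simp [Matrix.mulVec, dotProduct, Fin.sum_univ_two]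
  field_simp
  ring

end S19

theorem stmt19 (hA hB hAB : ℝ) (hW : (covW hA hB hAB).PosDef)
    (α : ℝ) (hα : α ∈ Set.Ioo (0 : ℝ) 1) (hαQ : ∃ q : ℚ, (q : ℝ) = α) :
    Tendsto
      (fun N : ℕ =>
        Zgauss ⌊α * N⌋₊ (N - ⌊α * N⌋₊) hA hB hAB /
          Zstar ⌊α * N⌋₊ (N - ⌊α * N⌋₊) hA hB hAB)
      (atTop ⊓ 𝓟 {N : ℕ | ∃ m : ℕ, (m : ℝ) = α * N}) (𝓝 1) := by
  refine Tendsto.mono_left ?_ inf_le_left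
  obtain ⟨hα0, hα1⟩ := hα
  have hdet := hW.det_pos
  set A := Real.exp hA with hAd
  set B := Real.exp hB with hBd
  set C := Real.exp hAB with hCd
  have pA : 0 < A := Real.exp_pos _
  have pB : 0 < B := Real.exp_pos _
  have pC : 0 < C := Real.exp_pos _
  have hWd : covW hA hB hAB = !![A, C; C, B] := rfl
  obtain ⟨D, hD⟩ : ∃ D, D = A * B - C ^ 2 := ⟨_, rfl⟩
  have hD0 : 0 < D := by
    rw [hWd, Matrix.det_fin_two_of] at hdet
    rw [hD]; linarith
  -- choice of the cutoff
  obtain ⟨K, hK, hKA, hKB⟩ : ∃ K : ℝ, 1 < K ∧ 4 ≤ Real.exp (3 * K ^ 2 / (8 * A)) ∧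
      4 ≤ Real.exp (3 * K ^ 2 / (8 * B)) := by
    have lim : ∀ a : ℝ, 0 < a →
        Tendsto (fun K : ℝ => Real.exp (3 * K ^ 2 / (8 * a))) atTop atTop := by
      intro a ha
      refine Real.tendsto_exp_atTop.comp ?_
      exact ((tendsto_pow_atTop two_ne_zero).const_mul_atTop (by norm_num)).atTop_div_const
        (by positivity)
    exact ((eventually_gt_atTop 1).and (((lim A pA).eventually_ge_atTop 4).and
      ((lim B pB).eventually_ge_atTop 4))).exists
  have hr0 : 0 ≤ (K - 1) / (K + 1) := (div_pos (by linarith) (by linarith)).le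
  have hr1 : (K - 1) / (K + 1) < 1 := by rw [div_lt_one (by linarith)]; linarith
  have hNA : Tendsto (fun N : ℕ => ⌊α * N⌋₊) atTop atTop :=
    tendsto_nat_floor_atTop.comp (tendsto_natCast_atTop_atTop.const_mul_atTop hα0)
  have hNB : Tendsto (fun N : ℕ => N - ⌊α * N⌋₊) atTop atTop := by
    have h1 : Tendsto (fun N : ℕ => ⌊(1 - α) * N⌋₊) atTop atTop :=
      tendsto_nat_floor_atTop.comp
        (tendsto_natCast_atTop_atTop.const_mul_atTop (by linarith))
    refine tendsto_atTop_mono (fun N => ?_) h1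
    have hN0 : (0 : ℝ) ≤ N := Nat.cast_nonneg N
    have f1 := Nat.floor_le (mul_nonneg hα0.le hN0)
    have f2 := Nat.floor_le (mul_nonneg (by linarith : 0 ≤ 1 - α) hN0)
    have : ((⌊(1 - α) * N⌋₊ + ⌊α * N⌋₊ : ℕ) : ℝ) ≤ (N : ℝ) := by push_cast; linarith
    have := Nat.cast_le.1 this
    omega
  have hsum : Tendsto (fun N : ℕ => ⌊α * N⌋₊ + (N - ⌊α * N⌋₊)) atTop atTop :=
    hNA.atTop_add_atTop hNB
  have hpow := tendsto_pow_atTop_nhds_zero_of_lt_one hr0 hr1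
  have hpow2 := tendsto_pow_atTop_nhds_zero_of_lt_one (r := (1 / 2 : ℝ)) (by norm_num) (by norm_num)
  have hlim := (((hpow.comp hNA).add (hpow.comp hNB)).add
    ((hpow2.comp hsum).const_mul 4)).const_mul 4
  simp only [add_zero, mul_zero] at hlim
  rw [tendsto_iff_norm_sub_tendsto_zero]
  refine squeeze_zero' (Eventually.of_forall fun _ => norm_nonneg _) ?_ hlim
  filter_upwards [hNA.eventually_ge_atTop 1] with N hN
  simp only [Function.comp]
  generalize ⌊α * N⌋₊ = a at *
  generalize N - a = b at *
  have hn : (0 : ℝ) < ((a + b : ℕ) : ℝ) := by exact_mod_cast (by omega : 0 < a + b)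
  have hk : 0 < (2 * Real.pi)⁻¹ * (Real.sqrt ((((a + b : ℕ) : ℝ))⁻¹ • !![A, C; C, B] :
      Matrix (Fin 2) (Fin 2) ℝ).det)⁻¹ := by
    have : 0 < ((((a + b : ℕ) : ℝ))⁻¹ • !![A, C; C, B] : Matrix (Fin 2) (Fin 2) ℝ).det := by
      rw [Matrix.det_smul, ← hWd]; positivity
    have := Real.sqrt_pos.2 this
    positivity
  have hb := S19.main_bound a b hk (t := ((a + b : ℕ) : ℝ) / (2 * D)) (by positivity) pA pB pC hD hD0
    rfl hK hKA hKB
  rw [Real.norm_eq_abs]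
  unfold Zgauss Zstar
  simp only [hWd, S19.dens_eq hn hD hD0]
  exact hb
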